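/- Let d ≥ 1 and let {V_p}_{p≥2}, V_p : (ℝ^d)^p → ℝ, be a family of p-body potentials satisfying assumptions A1–A4 with respect to a partition of ℝ^d into cubes of side λ. Suppose the two-body part U^(2)(γ) = Σ_{{x,y}⊂γ} V_2(x,y) is strongly superstable for this partition, i.e. there exist A > 0, B_2 ≥ 0 and m > 2 with U^(2)(γ) ≥ A Σ_Δ |γ_Δ|^m − B_2|γ| for every finite configuration γ. If for every p > 2 one has (1) V_p^p(Δ)/p^p − p·I_p^{1|p−1}(Δ) ≥ 0 for every cube Δ, and (2) Σ_{p>2} p^{p+1} I_p^{1|p−1}(Δ) < +∞, then the full interaction is strongly superstable: U(γ) ≥ A Σ_Δ |γ_Δ|^m − B|γ| for every finite configuration γ, with B = B_2 + Σ_{p>2} p^{p+1} I_p^{1|p−1}. -/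

import Mathlib

open MeasureTheory
open scoped ENNReal BigOperators

noncomputable section

/-- Points of `ℝ^d`. -/
abbrev Pt (d : ℕ) := EuclideanSpace ℝ (Fin d)

/-- The elementary cube with rib `lam` centered at the lattice point `lam • r`. -/
def cube (d : ℕ) (lam : ℝ) (r : Fin d → ℤ) : Set (Pt d) :=
  {x | ∀ i, lam * ((r i : ℝ) - 1 / 2) ≤ x i ∧ x i < lam * ((r i : ℝ) + 1 / 2)}

open scoped Classical in
/-- `|γ_Δ|`: the number of points of the finite configuration `γ` in the cube labelled `r`. -/
def occupancy (d : ℕ) (lam : ℝ) (γ : Finset (Pt d)) (r : Fin d → ℤ) : ℕ :=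
  (γ.filter fun x => x ∈ cube d lam r).card

/-- Concatenate a `k`-tuple and a `(p-k)`-tuple into a `p`-tuple. -/
def joinAt {α : Type*} (p k : ℕ) (h : k ≤ p) (y : Fin k → α) (z : Fin (p - k) → α) :
    Fin p → α :=
  fun i => Fin.append y z (Fin.cast ((Nat.add_sub_cancel' h).symm) i)

/-- The set of (ordered) pairs `i < j` in `Fin p`. -/
def pairs (p : ℕ) : Finset (Fin p × Fin p) := Finset.univ.filter fun q => q.1 < q.2

/-- `Σ_{1 ≤ i < j ≤ p} |x_i - x_j|`. -/
def pairSum (p : ℕ) (x : Fin p → ℝ) : ℝ := ∑ q ∈ pairs p, |x q.1 - x q.2|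

/-- `I_p^{k_1,…,k_n}(Δ_1,…,Δ_n)`: the sup of `|V_p^-|` over choices of `k_1` points in the
cube labelled `r 1`, …, `k_n` points in the cube labelled `r n`. -/
def IblocksT (d : ℕ) (lam : ℝ) (V : (p : ℕ) → (Fin p → Pt d) → ℝ) (p : ℕ)
    {n : ℕ} (ks : Fin n → ℕ) (r : Fin n → Fin d → ℤ) : ℝ≥0∞ :=
  ⨆ (x : Fin p → Pt d) (_ : ∃ c : Fin p → Fin n,
      (∀ i, x i ∈ cube d lam (r (c i))) ∧
      ∀ b, (Finset.univ.filter fun i => c i = b).card = ks b),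
    ENNReal.ofReal |min (V p x) 0|

/-- The analogue of `IblocksT` where the number of points to be put in the cube labelled `s`
is prescribed by the function `κ`. -/
def IblocksF (d : ℕ) (lam : ℝ) (V : (p : ℕ) → (Fin p → Pt d) → ℝ) (p : ℕ)
    (κ : (Fin d → ℤ) → ℕ) : ℝ≥0∞ :=
  ⨆ (x : Fin p → Pt d) (_ : ∃ c : Fin p → Fin d → ℤ,
      (∀ i, x i ∈ cube d lam (c i)) ∧
      ∀ s, (Finset.univ.filter fun i => c i = s).card = κ s),
    ENNReal.ofReal |min (V p x) 0|

/-- `I_p^{k|m}(Δ)`: the sum over all ordered `m`-tuples of cubes `(Δ_1,…,Δ_m)` of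
`I_p^{k,1,…,1}(Δ,Δ_1,…,Δ_m)`, where `Δ` is the cube labelled `r`. -/
def Ikm (d : ℕ) (lam : ℝ) (V : (p : ℕ) → (Fin p → Pt d) → ℝ) (p k m : ℕ)
    (r : Fin d → ℤ) : ℝ≥0∞ :=
  ∑' rs : Fin m → Fin d → ℤ,
    IblocksT d lam V p (Fin.cons k fun _ => 1) (Fin.cons r rs)

/-- `I_p^{k | {k_1,…,k_m}}(Δ)`: the sum over all unordered families of pairwise distinct
cubes, all different from `Δ`, carrying the multiset of counts `K`, of the corresponding
`I_p^{k,k_{π(1)},…,k_{π(m)}}(Δ,Δ_1,…,Δ_m)` (distinct rearrangements counted once). -/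
def IpartSet (d : ℕ) (lam : ℝ) (V : (p : ℕ) → (Fin p → Pt d) → ℝ) (p : ℕ)
    (k : ℕ) (K : Multiset ℕ) (r : Fin d → ℤ) : ℝ≥0∞ :=
  ∑' κ : {κ : (Fin d → ℤ) → ℕ //
      κ r = 0 ∧ ∃ S : Finset (Fin d → ℤ), (∀ s, κ s ≠ 0 ↔ s ∈ S) ∧ S.val.map κ = K},
    IblocksF d lam V p (Function.update (κ : (Fin d → ℤ) → ℕ) r k)

/-- `V_p^p(Δ)`: the infimum of `V_p^+` over `p`-tuples of points of the cube labelled `r`. -/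
def Vpp (d : ℕ) (lam : ℝ) (V : (p : ℕ) → (Fin p → Pt d) → ℝ) (p : ℕ)
    (r : Fin d → ℤ) : ℝ :=
  ⨅ x : {x : Fin p → Pt d // ∀ i, x i ∈ cube d lam r}, max (V p (x : Fin p → Pt d)) 0

/-- Evaluation of `V_p` on a `p`-element finite set of points (well defined for symmetric
`V_p`). -/
def evalSubset (d : ℕ) (V : (p : ℕ) → (Fin p → Pt d) → ℝ) (p : ℕ) (η : Finset (Pt d)) : ℝ :=
  if h : η.toList.length = p then V p (fun i => η.toList.get (Fin.cast h.symm i)) else 0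

/-- `U^{(p)}(γ) = Σ_{{x_1,…,x_p} ⊂ γ} V_p(x_1,…,x_p)`. -/
def pEnergy (d : ℕ) (V : (p : ℕ) → (Fin p → Pt d) → ℝ) (p : ℕ) (γ : Finset (Pt d)) : ℝ :=
  ∑ η ∈ γ.powersetCard p, evalSubset d V p η

/-- `U(γ) = Σ_{p ≥ 2} U^{(p)}(γ)`. -/
def energy (d : ℕ) (V : (p : ℕ) → (Fin p → Pt d) → ℝ) (γ : Finset (Pt d)) : ℝ :=
  ∑ p ∈ Finset.Icc 2 γ.card, pEnergy d V p γ

/-- Assumptions A1–A4 of the paper. -/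
structure ManyBodyAssumptions (d : ℕ) (lam : ℝ)
    (V : (p : ℕ) → (Fin p → Pt d) → ℝ) : Prop where
  /-- A1: symmetry. -/
  symm : ∀ p, 2 ≤ p → ∀ (x : Fin p → Pt d) (π : Equiv.Perm (Fin p)), V p (x ∘ π) = V p x
  /-- A2: translation invariance. -/
  transl : ∀ p, 2 ≤ p → ∀ (x : Fin p → Pt d) (a : Pt d), V p (fun i => x i + a) = V p x
  /-- A3: repulsion for small distances. -/
  repel : ∀ p, 2 ≤ p → ∀ (r : Fin d → ℤ) (x : Fin p → Pt d),
    (∀ i, x i ∈ cube d lam r) → 0 ≤ V p x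
  /-- A4: integrability. -/
  integrable : ∀ p (hp : 2 ≤ p) k (hk1 : 1 ≤ k) (hk2 : k ≤ p - 1),
    (⨆ y : Fin k → Pt d, ∫⁻ z : Fin (p - k) → Pt d,
      ENNReal.ofReal |min (V p (joinAt p k (by omega) y z)) 0|) < ⊤

end

/-- The label of the elementary cube containing `x`. -/
noncomputable def cell (d : ℕ) (lam : ℝ) (x : Pt d) : Fin d → ℤ := fun i => ⌊x i / lam + 1 / 2⌋

theorem mem_cube_cell {d : ℕ} {lam : ℝ} (hlam : 0 < lam) (x : Pt d) :
    x ∈ cube d lam (cell d lam x) := by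
  intro i
  have h1 := Int.floor_le (x i / lam + 1 / 2)
  have h2 := Int.lt_floor_add_one (x i / lam + 1 / 2)
  have hx : x i = lam * (x i / lam) := by field_simp
  simp only [cell]
  constructor
  · conv_rhs => rw [hx]
    exact mul_le_mul_of_nonneg_left (by linarith) hlam.le
  · conv_lhs => rw [hx]
    exact mul_lt_mul_of_pos_left (by linarith) hlam

/-- The number of points of `γ` whose cell is `r`. -/
noncomputable def cellCount (d : ℕ) (lam : ℝ) (γ : Finset (Pt d)) (r : Fin d → ℤ) : ℕ :=
  (γ.filter fun x => cell d lam x = r).card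

theorem sum_cellCount (d : ℕ) (lam : ℝ) (γ : Finset (Pt d)) :
    ∑ r ∈ γ.image (cell d lam), cellCount d lam γ r = γ.card :=
  (Finset.card_eq_sum_card_image (cell d lam) γ).symm

section Suprema

variable {d : ℕ} {lam : ℝ} {V : (p : ℕ) → (Fin p → Pt d) → ℝ}

theorem IblocksT_one_comp_le {p : ℕ} (ρ : Fin p → Fin d → ℤ) (σ : Equiv.Perm (Fin p)) :
    IblocksT d lam V p (fun _ => 1) ρ ≤ IblocksT d lam V p (fun _ => 1) (ρ ∘ σ) := by
  refine iSup₂_le fun x hx => ?_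
  obtain ⟨c, hc, hb⟩ := hx
  refine le_iSup₂_of_le x ⟨fun i => σ.symm (c i), fun i => by simpa using hc i, fun b => ?_⟩ le_rfl
  simpa [Equiv.symm_apply_eq] using hb (σ b)

theorem IblocksT_one_comp {p : ℕ} (ρ : Fin p → Fin d → ℤ) (σ : Equiv.Perm (Fin p)) :
    IblocksT d lam V p (fun _ => 1) (ρ ∘ σ) = IblocksT d lam V p (fun _ => 1) ρ := by
  refine le_antisymm ?_ (IblocksT_one_comp_le ρ σ)
  have h := IblocksT_one_comp_le (lam := lam) (V := V) (ρ ∘ σ) σ.symm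
  simpa [Function.comp_assoc] using h

theorem le_IblocksT_one {p : ℕ} (x : Fin p → Pt d) (ρ : Fin p → Fin d → ℤ)
    (hx : ∀ i, x i ∈ cube d lam (ρ i)) :
    ENNReal.ofReal |min (V p x) 0| ≤ IblocksT d lam V p (fun _ => 1) ρ := by
  refine le_iSup₂_of_le x ⟨id, hx, fun b => ?_⟩ le_rfl
  simp [Finset.filter_eq']

theorem IblocksT_le_add (HA : ManyBodyAssumptions d lam V) {p n : ℕ} (hp : 2 ≤ p)
    (ks : Fin n → ℕ) (ρ : Fin n → Fin d → ℤ) (a : Fin d → ℤ) :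
    IblocksT d lam V p ks ρ ≤ IblocksT d lam V p ks (fun i => ρ i + a) := by
  refine iSup₂_le fun x hx => ?_
  obtain ⟨c, hc, hb⟩ := hx
  let v : Pt d := WithLp.toLp 2 fun i => lam * (a i : ℝ)
  refine le_iSup₂_of_le (fun i => x i + v) ⟨c, fun i j => ?_, hb⟩ ?_
  · have h := hc i j
    have hv : (x i + v) j = x i j + lam * (a j : ℝ) := rfl
    rw [hv]
    simp only [Pi.add_apply, Int.cast_add]
    constructor <;> nlinarith [h.1, h.2]
  · rw [HA.transl p hp x v]

theorem IblocksT_add (HA : ManyBodyAssumptions d lam V) {p n : ℕ} (hp : 2 ≤ p)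
    (ks : Fin n → ℕ) (ρ : Fin n → Fin d → ℤ) (a : Fin d → ℤ) :
    IblocksT d lam V p ks (fun i => ρ i + a) = IblocksT d lam V p ks ρ := by
  refine le_antisymm ?_ (IblocksT_le_add HA hp ks ρ a)
  simpa using IblocksT_le_add HA hp ks (fun i => ρ i + a) (-a)

theorem Ikm_eq_zero_label (HA : ManyBodyAssumptions d lam V) {p : ℕ} (hp : 2 ≤ p) (k m : ℕ)
    (r : Fin d → ℤ) : Ikm d lam V p k m r = Ikm d lam V p k m 0 := by
  unfold Ikm
  rw [← (Equiv.addRight (fun _ : Fin m => r)).tsum_eq]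
  refine tsum_congr fun rs => ?_
  rw [← IblocksT_add HA hp _ (Fin.cons 0 rs : Fin (m + 1) → Fin d → ℤ) r]
  congr 1
  ext i : 1
  refine Fin.cases ?_ (fun j => ?_) i <;> simp

theorem Ikm_one_eq_tsum (q : ℕ) (r : Fin d → ℤ) :
    Ikm d lam V (q + 1) 1 q r =
      ∑' rs : Fin q → Fin d → ℤ, IblocksT d lam V (q + 1) (fun _ => 1) (Fin.cons r rs) := by
  have h : (Fin.cons 1 fun _ => 1 : Fin (q + 1) → ℕ) = fun _ => 1 := by
    ext i
    refine Fin.cases ?_ (fun j => ?_) i <;> simp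
  simp only [Ikm, h]

theorem tsum_mul_IblocksT_one (q : ℕ) (h : (Fin d → ℤ) → ℝ≥0∞) (i : Fin (q + 1)) :
    ∑' ρ : Fin (q + 1) → Fin d → ℤ, h (ρ i) * IblocksT d lam V (q + 1) (fun _ => 1) ρ =
      ∑' r, h r * Ikm d lam V (q + 1) 1 q r := by
  rw [← ((Equiv.swap 0 i).arrowCongr (Equiv.refl (Fin d → ℤ))).tsum_eq]
  have hswap : ∀ ρ : Fin (q + 1) → Fin d → ℤ,
      ((Equiv.swap 0 i).arrowCongr (Equiv.refl (Fin d → ℤ))) ρ = ρ ∘ Equiv.swap 0 i :=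
    fun ρ => rfl
  simp only [hswap, IblocksT_one_comp, Function.comp_apply, Equiv.swap_apply_right]
  rw [← (Fin.consEquiv fun _ : Fin (q + 1) => (Fin d → ℤ)).tsum_eq, ENNReal.tsum_prod']
  refine tsum_congr fun r => ?_
  rw [Ikm_one_eq_tsum, ← ENNReal.tsum_mul_left]
  rfl

end Suprema

theorem prod_le_sum_pow_card {ι : Type*} [Fintype ι] [Nonempty ι] (f : ι → ℕ) :
    ∏ i, f i ≤ ∑ i, f i ^ Fintype.card ι := by
  obtain ⟨i, hi⟩ := Finite.exists_max f
  calc ∏ j, f j ≤ f i ^ Fintype.card ι := Finset.prod_le_pow_card _ _ _ fun j _ => hi j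
    _ ≤ _ := Finset.single_le_sum (f := fun i => f i ^ Fintype.card ι)
      (fun _ _ => Nat.zero_le _) (Finset.mem_univ i)

theorem pow_le_pow_mul_choose {n p : ℕ} (h : p ≤ n) : n ^ p ≤ p ^ p * n.choose p := by
  have key : n ^ p * p.descFactorial p ≤ p ^ p * n.descFactorial p := by
    rw [Nat.descFactorial_eq_prod_range, Nat.descFactorial_eq_prod_range,
      Finset.pow_eq_prod_const, Finset.pow_eq_prod_const, ← Finset.prod_mul_distrib,
      ← Finset.prod_mul_distrib]
    refine Finset.prod_le_prod' fun i _ => ?_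
    rw [Nat.mul_sub, Nat.mul_sub, mul_comm p n]
    exact Nat.sub_le_sub_left (Nat.mul_le_mul_right i h) _
  rw [Nat.descFactorial_self, Nat.descFactorial_eq_factorial_mul_choose, mul_left_comm,
    mul_comm _ p.factorial] at key
  exact Nat.le_of_mul_le_mul_left key p.factorial_pos

theorem mul_pow_le_choose_add (n p : ℕ) :
    p * n ^ p ≤ p ^ (p + 1) * n.choose p + p ^ (p + 1) * n := by
  rcases le_or_gt p n with h | h
  · calc p * n ^ p ≤ p * (p ^ p * n.choose p) := Nat.mul_le_mul_left _ (pow_le_pow_mul_choose h)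
      _ = p ^ (p + 1) * n.choose p := by ring
      _ ≤ _ := Nat.le_add_right _ _
  · refine le_trans ?_ (Nat.le_add_left _ _)
    obtain ⟨q, rfl⟩ : ∃ q, p = q + 1 := ⟨p - 1, by omega⟩
    calc (q + 1) * n ^ (q + 1) = (q + 1) * n ^ q * n := by ring
      _ ≤ (q + 1) * (q + 1) ^ q * n := by gcongr
      _ = (q + 1) ^ (q + 1) * n := by ring
      _ ≤ (q + 1) ^ (q + 1 + 1) * n := by gcongr <;> omega

/-- An enumeration of each finite configuration computing `evalSubset`. -/
theorem exists_enumeration (d : ℕ) (V : (p : ℕ) → (Fin p → Pt d) → ℝ) (p : ℕ) :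
    ∃ t : Finset (Pt d) → Fin p → Pt d, ∀ η : Finset (Pt d), η.card = p →
      evalSubset d V p η = V p (t η) ∧ Set.range (t η) = η := by
  have h : ∀ η : Finset (Pt d), ∃ x : Fin p → Pt d, η.card = p →
      evalSubset d V p η = V p x ∧ Set.range x = η := by
    intro η
    by_cases hη : η.toList.length = p
    · refine ⟨fun i => η.toList.get (Fin.cast hη.symm i), fun _ => ⟨by simp [evalSubset, hη], ?_⟩⟩
      ext y
      have hy : y ∈ (η : Set (Pt d)) ↔ y ∈ η.toList := by simp
      rw [hy, List.mem_iff_get]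
      constructor
      · rintro ⟨i, rfl⟩
        exact ⟨_, rfl⟩
      · rintro ⟨i, rfl⟩
        exact ⟨Fin.cast hη i, rfl⟩
    · exact ⟨fun _ => 0, fun hc => absurd (by simpa using hc) hη⟩
  choose t ht using h
  exact ⟨t, ht⟩

theorem sum_piFinset_cell (d : ℕ) (lam : ℝ) (γ : Finset (Pt d)) (p : ℕ)
    (g : (Fin p → Fin d → ℤ) → ℝ≥0∞) :
    ∑ x ∈ Fintype.piFinset fun _ : Fin p => γ, g (fun i => cell d lam (x i)) ≤
      ∑' ρ : Fin p → Fin d → ℤ, ((∏ i, cellCount d lam γ (ρ i) : ℕ) : ℝ≥0∞) * g ρ := by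
  classical
  rw [Finset.sum_comp g fun (x : Fin p → Pt d) i => cell d lam (x i)]
  refine le_trans (Finset.sum_le_sum fun ρ _ => ?_) (ENNReal.sum_le_tsum _)
  rw [nsmul_eq_mul]
  gcongr
  unfold cellCount
  rw [← Fintype.card_piFinset]
  refine Finset.card_le_card fun x hx => ?_
  simp only [Finset.mem_filter, Fintype.mem_piFinset] at hx ⊢
  exact fun i => ⟨hx.1 i, congrFun hx.2 i⟩

section Energy

variable {d : ℕ} {lam : ℝ} {V : (p : ℕ) → (Fin p → Pt d) → ℝ}

theorem sum_negPart_le (hlam : 0 < lam) (γ : Finset (Pt d)) (q : ℕ) :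
    ∑ η ∈ γ.powersetCard (q + 1), ENNReal.ofReal |min (evalSubset d V (q + 1) η) 0| ≤
      (q + 1 : ℕ) * ∑ r ∈ γ.image (cell d lam),
        (cellCount d lam γ r : ℝ≥0∞) ^ (q + 1) * Ikm d lam V (q + 1) 1 q r := by
  classical
  obtain ⟨t, ht⟩ := exists_enumeration d V (q + 1)
  set J := IblocksT d lam V (q + 1) (fun _ => 1)
  calc
    _ ≤ ∑ η ∈ γ.powersetCard (q + 1), J (fun i => cell d lam (t η i)) := by
      refine Finset.sum_le_sum fun η hη => ?_
      rw [(ht η (Finset.mem_powersetCard.1 hη).2).1]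
      exact le_IblocksT_one _ _ fun i => mem_cube_cell hlam _
    _ = ∑ x ∈ (γ.powersetCard (q + 1)).image t, J (fun i => cell d lam (x i)) := by
      rw [Finset.sum_image]
      intro η hη η' hη' h
      have e := (ht η (Finset.mem_powersetCard.1 hη).2).2
      have e' := (ht η' (Finset.mem_powersetCard.1 hη').2).2
      rw [h, e'] at e
      exact (Finset.coe_injective e).symm
    _ ≤ ∑ x ∈ Fintype.piFinset fun _ : Fin (q + 1) => γ, J (fun i => cell d lam (x i)) := by
      refine Finset.sum_le_sum_of_subset fun x hx => ?_
      obtain ⟨η, hη, rfl⟩ := Finset.mem_image.1 hx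
      obtain ⟨hsub, hcard⟩ := Finset.mem_powersetCard.1 hη
      refine Fintype.mem_piFinset.2 fun i => hsub ?_
      rw [← Finset.mem_coe, ← (ht η hcard).2]
      exact ⟨i, rfl⟩
    _ ≤ ∑' ρ : Fin (q + 1) → Fin d → ℤ,
        ((∏ i, cellCount d lam γ (ρ i) : ℕ) : ℝ≥0∞) * J ρ := sum_piFinset_cell d lam γ _ J
    _ ≤ ∑' ρ : Fin (q + 1) → Fin d → ℤ,
        ∑ i, (cellCount d lam γ (ρ i) : ℝ≥0∞) ^ (q + 1) * J ρ := by
      refine ENNReal.tsum_le_tsum fun ρ => ?_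
      rw [← Finset.sum_mul]
      gcongr
      have h := prod_le_sum_pow_card fun i => cellCount d lam γ (ρ i)
      rw [Fintype.card_fin] at h
      exact_mod_cast h
    _ = ∑ i : Fin (q + 1), ∑' r, (cellCount d lam γ r : ℝ≥0∞) ^ (q + 1) *
        Ikm d lam V (q + 1) 1 q r := by
      rw [Summable.tsum_finsetSum fun _ _ => ENNReal.summable]
      exact Finset.sum_congr rfl fun i _ => tsum_mul_IblocksT_one q
        (fun r => (cellCount d lam γ r : ℝ≥0∞) ^ (q + 1)) i
    _ = _ := by
      rw [Finset.sum_const, Finset.card_univ, Fintype.card_fin, nsmul_eq_mul]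
      congr 1
      refine tsum_eq_sum fun r hr => ?_
      have h0 : cellCount d lam γ r = 0 := by
        refine Finset.card_eq_zero.2 (Finset.filter_eq_empty_iff.2 fun x hx h => hr ?_)
        exact Finset.mem_image.2 ⟨x, hx, h⟩
      simp [h0]

theorem Vpp_le {p : ℕ} {r : Fin d → ℤ} {x : Fin p → Pt d} (hx : ∀ i, x i ∈ cube d lam r) :
    Vpp d lam V p r ≤ max (V p x) 0 :=
  ciInf_le (f := fun x : {x : Fin p → Pt d // ∀ i, x i ∈ cube d lam r} =>
      max (V p (x : Fin p → Pt d)) 0)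
    ⟨0, by rintro _ ⟨y, rfl⟩; exact le_max_right _ _⟩ ⟨x, hx⟩

theorem le_sum_posPart (hlam : 0 < lam) (γ : Finset (Pt d)) {p : ℕ} (hp : p ≠ 0) :
    ∑ r ∈ γ.image (cell d lam), ((cellCount d lam γ r).choose p : ℝ) * Vpp d lam V p r ≤
      ∑ η ∈ γ.powersetCard p, max (evalSubset d V p η) 0 := by
  classical
  obtain ⟨t, ht⟩ := exists_enumeration d V p
  let fib : (Fin d → ℤ) → Finset (Finset (Pt d)) := fun r =>
    (γ.filter fun x => cell d lam x = r).powersetCard p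
  calc
    _ ≤ ∑ r ∈ γ.image (cell d lam), ∑ η ∈ fib r, max (evalSubset d V p η) 0 := by
      refine Finset.sum_le_sum fun r _ => ?_
      rw [cellCount, ← Finset.card_powersetCard, ← nsmul_eq_mul]
      refine Finset.card_nsmul_le_sum _ _ _ fun η hη => ?_
      obtain ⟨hsub, hcard⟩ := Finset.mem_powersetCard.1 hη
      rw [(ht η hcard).1]
      refine Vpp_le fun i => ?_
      have hi : t η i ∈ η := by
        rw [← Finset.mem_coe, ← (ht η hcard).2]
        exact ⟨i, rfl⟩
      rw [← (Finset.mem_filter.1 (hsub hi)).2]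
      exact mem_cube_cell hlam _
    _ = ∑ η ∈ (γ.image (cell d lam)).biUnion fib, max (evalSubset d V p η) 0 := by
      rw [Finset.sum_biUnion]
      intro r _ r' _ hne
      refine Finset.disjoint_left.2 fun η hη hη' => hne ?_
      obtain ⟨hsub, hcard⟩ := Finset.mem_powersetCard.1 hη
      obtain ⟨x, hx⟩ : η.Nonempty := Finset.card_ne_zero.1 (hcard ▸ hp)
      rw [← (Finset.mem_filter.1 (hsub hx)).2,
        (Finset.mem_filter.1 ((Finset.mem_powersetCard.1 hη').1 hx)).2]
    _ ≤ _ := by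
      refine Finset.sum_le_sum_of_subset_of_nonneg ?_ fun _ _ _ => le_max_right _ _
      exact Finset.biUnion_subset.2 fun r _ => Finset.powersetCard_mono (Finset.filter_subset _ _)

/-- Stability of the `p`-body energy. -/
theorem neg_le_pEnergy (hlam : 0 < lam) (HA : ManyBodyAssumptions d lam V) {p : ℕ} (hp : 2 < p)
    (hV : ∀ r : Fin d → ℤ,
      0 ≤ Vpp d lam V p r / (p : ℝ) ^ p - (p : ℝ) * (Ikm d lam V p 1 (p - 1) r).toReal)
    (hI : Ikm d lam V p 1 (p - 1) 0 ≠ ⊤) (γ : Finset (Pt d)) :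
    -((p : ℝ) ^ (p + 1) * (Ikm d lam V p 1 (p - 1) 0).toReal * γ.card) ≤ pEnergy d V p γ := by
  obtain ⟨q, rfl⟩ : ∃ q, p = q + 1 := ⟨p - 1, by omega⟩
  simp only [Nat.add_sub_cancel] at hV hI ⊢
  have hIr := Ikm_eq_zero_label HA (p := q + 1) (by omega) 1 q
  simp only [hIr] at hV
  set I := (Ikm d lam V (q + 1) 1 q 0).toReal
  have hI0 : 0 ≤ I := ENNReal.toReal_nonneg
  set P : ℝ := ((q + 1 : ℕ) : ℝ) with hPdef
  have hP : 0 < P := by positivity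
  have hneg : ∑ η ∈ γ.powersetCard (q + 1), |min (evalSubset d V (q + 1) η) 0| ≤
      ∑ r ∈ γ.image (cell d lam), P * (cellCount d lam γ r : ℝ) ^ (q + 1) * I := by
    have h := sum_negPart_le (V := V) hlam γ q
    simp only [hIr] at h
    rw [← ENNReal.ofReal_toReal hI, ← ENNReal.ofReal_sum_of_nonneg fun _ _ => abs_nonneg _,
      ← Finset.sum_mul] at h
    have h' := ENNReal.toReal_mono (ENNReal.mul_ne_top (ENNReal.natCast_ne_top _)
      (ENNReal.mul_ne_top (ENNReal.sum_ne_top.2 fun _ _ => by finiteness) ENNReal.ofReal_ne_top)) h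
    rw [ENNReal.toReal_ofReal (Finset.sum_nonneg fun _ _ => abs_nonneg _), ENNReal.toReal_mul,
      ENNReal.toReal_mul, ENNReal.toReal_sum (by finiteness), ENNReal.toReal_ofReal hI0,
      ENNReal.toReal_natCast] at h'
    refine h'.trans (le_of_eq ?_)
    simp [Finset.mul_sum, Finset.sum_mul, mul_assoc, hPdef]
  have hpos := le_sum_posPart (V := V) hlam γ (p := q + 1) (by omega)
  have hVI : ∀ r, P ^ (q + 2) * I ≤ Vpp d lam V (q + 1) r := by
    intro r
    have h := sub_nonneg.1 (hV r)
    rw [le_div_iff₀ (by positivity)] at h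
    calc P ^ (q + 2) * I = P * I * P ^ (q + 1) := by ring
      _ ≤ _ := h
  have hsplit : pEnergy d V (q + 1) γ =
      ∑ η ∈ γ.powersetCard (q + 1), max (evalSubset d V (q + 1) η) 0 -
        ∑ η ∈ γ.powersetCard (q + 1), |min (evalSubset d V (q + 1) η) 0| := by
    rw [pEnergy, ← Finset.sum_sub_distrib]
    refine Finset.sum_congr rfl fun η _ => ?_
    rw [abs_of_nonpos (min_le_right _ _), sub_neg_eq_add, max_add_min, add_zero]
  have hcell : ∀ r, -(P ^ (q + 2) * I * cellCount d lam γ r) ≤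
      ((cellCount d lam γ r).choose (q + 1) : ℝ) * Vpp d lam V (q + 1) r -
        P * (cellCount d lam γ r : ℝ) ^ (q + 1) * I := by
    intro r
    have h : P * (cellCount d lam γ r : ℝ) ^ (q + 1) ≤
        P ^ (q + 2) * ((cellCount d lam γ r).choose (q + 1) : ℝ) +
          P ^ (q + 2) * (cellCount d lam γ r : ℝ) := by
      rw [hPdef]
      exact_mod_cast mul_pow_le_choose_add (cellCount d lam γ r) (q + 1)
    have h1 := mul_le_mul_of_nonneg_right h hI0
    have h2 := mul_le_mul_of_nonneg_left (hVI r)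
      (Nat.cast_nonneg ((cellCount d lam γ r).choose (q + 1)))
    linarith
  have hsum := Finset.sum_le_sum fun r (_ : r ∈ γ.image (cell d lam)) => hcell r
  rw [Finset.sum_neg_distrib, ← Finset.mul_sum, ← Nat.cast_sum, sum_cellCount,
    Finset.sum_sub_distrib] at hsum
  rw [hsplit]
  linarith

end Energy

theorem statement2 (d : ℕ) (hd : 1 ≤ d) (lam : ℝ) (hlam : 0 < lam)
    (V : (p : ℕ) → (Fin p → Pt d) → ℝ) (HA : ManyBodyAssumptions d lam V)
    (A B₂ : ℝ) (m : ℝ) (hA : 0 < A) (hB₂ : 0 ≤ B₂) (hm : 2 < m)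
    (hstab : ∀ γ : Finset (Pt d),
      A * (∑' r : Fin d → ℤ, (occupancy d lam γ r : ℝ) ^ m) - B₂ * γ.card
        ≤ pEnergy d V 2 γ)
    (h1 : ∀ p, 2 < p → ∀ r : Fin d → ℤ,
      0 ≤ Vpp d lam V p r / (p : ℝ) ^ p - (p : ℝ) * (Ikm d lam V p 1 (p - 1) r).toReal)
    (h2 : ∀ r : Fin d → ℤ,
      (∑' p : ℕ, if 2 < p then (p : ℝ≥0∞) ^ (p + 1) * Ikm d lam V p 1 (p - 1) r else 0) ≠ ⊤) :
    ∀ γ : Finset (Pt d),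
      A * (∑' r : Fin d → ℤ, (occupancy d lam γ r : ℝ) ^ m)
        - (B₂ + (∑' p : ℕ,
            if 2 < p then (p : ℝ≥0∞) ^ (p + 1) * Ikm d lam V p 1 (p - 1) 0 else 0).toReal)
          * γ.card
      ≤ energy d V γ := by
  intro γ
  set F : ℕ → ℝ≥0∞ := fun p =>
    if 2 < p then (p : ℝ≥0∞) ^ (p + 1) * Ikm d lam V p 1 (p - 1) 0 else 0 with hF
  have hFtop : ∑' p, F p ≠ ⊤ := h2 0
  have hF1 : ∀ p, F p ≠ ⊤ := ENNReal.ne_top_of_tsum_ne_top hFtop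
  have hI : ∀ p, 2 < p → Ikm d lam V p 1 (p - 1) 0 ≠ ⊤ := by
    intro p hp htop
    refine hF1 p ?_
    simp only [hF, if_pos hp, htop]
    exact ENNReal.mul_top (pow_ne_zero _ (by simp; omega))
  have hFp : ∀ p, 2 < p → -((F p).toReal * γ.card) ≤ pEnergy d V p γ := by
    intro p hp
    simpa [hF, hp] using neg_le_pEnergy hlam HA hp (h1 p hp) (hI p hp) γ
  have hhigh : -((∑' p, F p).toReal * γ.card) ≤ ∑ p ∈ Finset.Icc 3 γ.card, pEnergy d V p γ := by
    have h := Finset.sum_le_sum fun p (hp : p ∈ Finset.Icc 3 γ.card) =>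
      hFp p (Finset.mem_Icc.1 hp).1
    rw [Finset.sum_neg_distrib, ← Finset.sum_mul, ← ENNReal.toReal_sum fun p _ => hF1 p] at h
    refine le_trans (neg_le_neg ?_) h
    gcongr
    exact ENNReal.sum_le_tsum _
  have henergy : energy d V γ = pEnergy d V 2 γ + ∑ p ∈ Finset.Icc 3 γ.card, pEnergy d V p γ := by
    rw [energy]
    rcases le_or_gt 2 γ.card with hc | hc
    · rw [← Finset.insert_Icc_add_one_left_eq_Icc hc, Finset.sum_insert (by simp)]
      rfl
    · rw [Finset.Icc_eq_empty (by omega), Finset.Icc_eq_empty (by omega), pEnergy,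
        Finset.powersetCard_eq_empty.2 hc]
      simp
  have h2body := hstab γ
  rw [henergy]
  linarith
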